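/- Let X be a finite connected graph without any terminal vertex which is not a cycle (equivalently, every vertex has valency at least 2 and some vertex has valency at least 3), and let ℓ be a length function on X. Then there exist a real number h > 0 and a vector (x_e)_{e∈E} with x_e > 0 for every e ∈ E such that x_e = Σ_{f∈E} ρ_{ef} e^{−h ℓ(f)} x_f for all e ∈ E. -/

import Mathlib

/-- A finite graph in the sense of Serre: oriented edges with a fixed-point-free
involution `bar`, and initial/terminal vertex maps `i`, `t`. -/
structure SerreGraph (V E : Type) where
  bar : E → E
  bar_bar : ∀ e, bar (bar e) = e
  bar_ne : ∀ e, bar e ≠ e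
  i : E → V
  t : E → V
  i_bar : ∀ e, i (bar e) = t e
  t_bar : ∀ e, t (bar e) = i e

namespace SerreGraph

variable {V E : Type}

/-- `rho G e f = 1` iff `ef` is a combinatorial path without backtracking. -/
def rho [DecidableEq V] [DecidableEq E] (G : SerreGraph V E) (e f : E) : ℝ :=
  if G.t e = G.i f ∧ G.bar e ≠ f then 1 else 0

/-- The edge adjacency matrix of the graph. -/
def adjMatrix [DecidableEq V] [DecidableEq E] (G : SerreGraph V E) : Matrix E E ℝ :=
  fun e f => G.rho e f

/-- The valency of a vertex: the number of edges with initial vertex `x`. -/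
noncomputable def valency (G : SerreGraph V E) (x : V) : ℕ :=
  Nat.card {e : E // G.i e = x}

/-- `G.k x` is the valency of `x` minus one. -/
noncomputable def k (G : SerreGraph V E) (x : V) : ℕ :=
  G.valency x - 1

/-- The graph is connected: the equivalence relation on vertices generated by
relating `i e` to `t e` has a single class. -/
def Connected (G : SerreGraph V E) : Prop :=
  ∀ x y : V, Relation.EqvGen (fun a b => ∃ e : E, G.i e = a ∧ G.t e = b) x y

/-- A nonnegative square matrix is reducible if the index set splits into two
nonempty complementary subsets with all entries between them vanishing. -/
def MatReducible (M : Matrix E E ℝ) : Prop :=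
  ∃ U : Set E, U.Nonempty ∧ Uᶜ.Nonempty ∧ ∀ u ∈ U, ∀ v ∈ Uᶜ, M u v = 0 ∧ M v u = 0

/-- A matrix is irreducible if it is not reducible. -/
def MatIrreducible (M : Matrix E E ℝ) : Prop :=
  ¬ MatReducible M

/-- A length function: positive and invariant under the edge involution. -/
def IsLengthFunction (G : SerreGraph V E) (ℓ : E → ℝ) : Prop :=
  (∀ e, 0 < ℓ e) ∧ ∀ e, ℓ (G.bar e) = ℓ e

end SerreGraph

namespace Matrix

open Filter Topology

variable {n : Type*} [Fintype n]

/-- An entrywise positive matrix maps nonzero nonnegative vectors to positive vectors. -/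
lemma mulVec_apply_pos {P : Matrix n n ℝ} (hP : ∀ a b, 0 < P a b) {x : n → ℝ}
    (hx : 0 ≤ x) (hx0 : x ≠ 0) (a : n) : 0 < (P *ᵥ x) a := by
  obtain ⟨b, hb⟩ := Function.ne_iff.1 hx0
  exact Finset.sum_pos' (fun j _ => mul_nonneg (hP a j).le (hx j))
    ⟨b, Finset.mem_univ _, mul_pos (hP a b) (lt_of_le_of_ne (hx b) (Ne.symm hb))⟩

/-- A matrix with nonnegative entries and all row and column sums one has no positive entries
leading into a set that is closed under following positive entries. -/
lemma mem_of_sums_eq_one {P : Matrix n n ℝ} (hP : ∀ a b, 0 ≤ P a b)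
    (hrow : ∀ a, ∑ b, P a b = 1) (hcol : ∀ b, ∑ a, P a b = 1) {U : Set n}
    (hU : ∀ a ∈ U, ∀ b, 0 < P a b → b ∈ U) {a b : n} (hb : b ∈ U) (hab : 0 < P a b) :
    a ∈ U := by
  classical
  by_contra ha
  let s : Finset n := Finset.univ.filter (· ∈ U)
  have h1 : ∑ c ∈ s, ∑ d ∈ s, P c d = ∑ c ∈ s, (1 : ℝ) := by
    refine Finset.sum_congr rfl fun c hc => ?_
    rw [← hrow c]
    refine Finset.sum_subset (Finset.subset_univ _) fun d _ hd => ?_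
    by_contra hne
    have hdU := hU c (Finset.mem_filter.1 hc).2 d (lt_of_le_of_ne (hP c d) (Ne.symm hne))
    exact hd (Finset.mem_filter.2 ⟨Finset.mem_univ d, hdU⟩)
  have h2 : ∑ d ∈ s, ∑ c, P c d = ∑ c ∈ s, (1 : ℝ) :=
    Finset.sum_congr rfl fun d _ => hcol d
  have h3 : ∑ d ∈ s, ∑ c ∈ s, P c d < ∑ d ∈ s, ∑ c, P c d := by
    refine Finset.sum_lt_sum (fun d _ => Finset.sum_le_sum_of_subset_of_nonneg
      (Finset.subset_univ _) fun c _ _ => hP c d) ⟨b, by simpa [s] using hb, ?_⟩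
    exact Finset.sum_lt_sum_of_subset (Finset.subset_univ _) (Finset.mem_univ a)
      (by simpa [s] using ha) hab fun c _ _ => hP c b
  rw [Finset.sum_comm, h1, h2] at h3
  exact lt_irrefl _ h3

variable [DecidableEq n] {B : Matrix n n ℝ}

/-- Powers of an entrywise nonnegative matrix are entrywise nonnegative. -/
lemma pow_apply_nonneg_of_nonneg (hB : ∀ a b, 0 ≤ B a b) (k : ℕ) (a b : n) :
    0 ≤ (B ^ k) a b := by
  induction k generalizing a b with
  | zero =>
    rw [pow_zero, one_apply]
    split_ifs <;> norm_num
  | succ k ih =>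
    rw [pow_succ, mul_apply]
    exact Finset.sum_nonneg fun c _ => mul_nonneg (ih a c) (hB c b)

/-- If `b` is reachable from `a` along positive entries of a nonnegative matrix, then some power
of the matrix has a positive `(a, b)` entry. -/
lemma exists_pow_apply_pos_of_reflTransGen (hB : ∀ a b, 0 ≤ B a b) {a b : n}
    (h : Relation.ReflTransGen (fun a b => 0 < B a b) a b) : ∃ k : ℕ, 0 < (B ^ k) a b := by
  induction h with
  | refl => exact ⟨0, by simp⟩
  | @tail c d _ hcd ih =>
    obtain ⟨k, hk⟩ := ih
    refine ⟨k + 1, ?_⟩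
    rw [pow_succ, mul_apply]
    exact Finset.sum_pos' (fun j _ => mul_nonneg (pow_apply_nonneg_of_nonneg hB k a j) (hB j d))
      ⟨c, Finset.mem_univ _, mul_pos hk hcd⟩

/-- A nonnegative matrix whose positive entries form a strongly connected digraph commutes with
an entrywise positive matrix. -/
lemma exists_commute_pos (hB : ∀ a b, 0 ≤ B a b)
    (hirr : ∀ a b, Relation.ReflTransGen (fun a b => 0 < B a b) a b) :
    ∃ P : Matrix n n ℝ, Commute P B ∧ ∀ a b, 0 < P a b := by
  choose k hk using fun p : n × n => exists_pow_apply_pos_of_reflTransGen hB (hirr p.1 p.2)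
  refine ⟨∑ p, B ^ k p, Commute.sum_left _ _ _ fun p _ => Commute.pow_left rfl _, fun a b => ?_⟩
  rw [sum_apply]
  exact Finset.sum_pos' (fun p _ => pow_apply_nonneg_of_nonneg hB _ a b)
    ⟨(a, b), Finset.mem_univ _, hk (a, b)⟩

/-- For an irreducible nonnegative matrix, a nonnegative vector with `x ≤ B x` and `x ≠ B x` can
be improved to a positive vector with strict inequality in every coordinate. -/
lemma exists_pos_lt_mulVec (hB : ∀ a b, 0 ≤ B a b)
    (hirr : ∀ a b, Relation.ReflTransGen (fun a b => 0 < B a b) a b) {x : n → ℝ}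
    (hx : 0 ≤ x) (hle : x ≤ B *ᵥ x) (hne : x ≠ B *ᵥ x) :
    ∃ y : n → ℝ, (∀ a, 0 < y a) ∧ ∀ a, y a < (B *ᵥ y) a := by
  obtain ⟨P, hcomm, hP⟩ := exists_commute_pos hB hirr
  have hx0 : x ≠ 0 := by
    rintro rfl
    simp at hne
  refine ⟨P *ᵥ x, mulVec_apply_pos hP hx hx0, fun a => ?_⟩
  have h := mulVec_apply_pos hP (sub_nonneg.2 hle) (sub_ne_zero.2 hne.symm) a
  rw [mulVec_sub, mulVec_mulVec, hcomm.eq, ← mulVec_mulVec] at h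
  exact sub_pos.1 h

/-- A nonzero nonnegative fixed vector of an irreducible nonnegative matrix is positive. -/
lemma pos_of_eq_mulVec (hB : ∀ a b, 0 ≤ B a b)
    (hirr : ∀ a b, Relation.ReflTransGen (fun a b => 0 < B a b) a b) {x : n → ℝ}
    (hx : 0 ≤ x) (hx0 : x ≠ 0) (heq : x = B *ᵥ x) (a : n) : 0 < x a := by
  obtain ⟨b, hb⟩ := Function.ne_iff.1 hx0
  obtain ⟨k, hk⟩ := exists_pow_apply_pos_of_reflTransGen hB (hirr a b)
  have hfix : ∀ k : ℕ, (B ^ k) *ᵥ x = x := by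
    intro k
    induction k with
    | zero => simp
    | succ k ih => rw [pow_succ, ← mulVec_mulVec, ← heq, ih]
  rw [← hfix k]
  exact Finset.sum_pos' (fun j _ => mul_nonneg (pow_apply_nonneg_of_nonneg hB k a j) (hx j))
    ⟨b, Finset.mem_univ _, mul_pos hk (lt_of_le_of_ne (hx b) (Ne.symm hb))⟩

/-- Let `B h` be a continuous family of irreducible nonnegative matrices tending to zero as
`h → ∞`, such that all row sums of `B 0` are at least one, and not all equal to one. Then some
`B h` with `h > 0` has a positive fixed vector. -/
theorem exists_pos_fixed_vector [Nonempty n] (B : ℝ → Matrix n n ℝ)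
    (hB : ∀ h a b, 0 ≤ B h a b)
    (hirr : ∀ h a b, Relation.ReflTransGen (fun a b => 0 < B h a b) a b)
    (hcont : ∀ a b, Continuous fun h => B h a b)
    (hlim : ∀ a b, Tendsto (fun h => B h a b) atTop (𝓝 0))
    (hone : (1 : n → ℝ) ≤ B 0 *ᵥ 1) (hne : (1 : n → ℝ) ≠ B 0 *ᵥ 1) :
    ∃ h : ℝ, 0 < h ∧ ∃ x : n → ℝ, (∀ a, 0 < x a) ∧ x = B h *ᵥ x := by
  obtain ⟨H, hH⟩ : ∃ H : ℝ, ∀ h, H ≤ h → ∑ a, ∑ b, B h a b < 1 := by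
    have : Tendsto (fun h => ∑ a, ∑ b, B h a b) atTop (𝓝 0) := by
      simpa using tendsto_finsetSum (Finset.univ : Finset n) fun a _ =>
        tendsto_finsetSum (Finset.univ : Finset n) fun b _ => hlim a b
    exact eventually_atTop.1 (this.eventually_lt_const one_pos)
  have hbound : ∀ h, ∀ x ∈ stdSimplex ℝ n, x ≤ B h *ᵥ x → h < H := by
    intro h x hx hle
    by_contra! hh
    have h1 : ∑ a, x a ≤ ∑ a, ∑ b, B h a b :=
      Finset.sum_le_sum fun a _ => (hle a).trans <| Finset.sum_le_sum fun b _ =>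
        mul_le_of_le_one_right (hB h a b) (by
          rw [← hx.2]
          exact Finset.single_le_sum (fun c _ => hx.1 c) (Finset.mem_univ b))
    rw [hx.2] at h1
    exact absurd (hH h hh) h1.not_gt
  have hincr : ∀ h (y : n → ℝ), (∀ a, 0 < y a) → (∀ a, y a < (B h *ᵥ y) a) →
      ∃ h' > h, ∃ x ∈ stdSimplex ℝ n, x ≤ B h' *ᵥ x := by
    intro h y hy hlt
    have hev : ∀ᶠ h' in 𝓝[>] h, ∀ a, y a < (B h' *ᵥ y) a := by
      refine eventually_all.2 fun a => Filter.Eventually.filter_mono nhdsWithin_le_nhds ?_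
      have hc : Continuous fun h' => (B h' *ᵥ y) a :=
        continuous_finsetSum _ fun b _ => (hcont a b).mul continuous_const
      exact hc.continuousAt.eventually (lt_mem_nhds (hlt a))
    obtain ⟨h', hh', hgt⟩ := (hev.and self_mem_nhdsWithin).exists
    have hs : 0 < ∑ a, y a := Finset.sum_pos (fun a _ => hy a) Finset.univ_nonempty
    refine ⟨h', hgt, (∑ a, y a)⁻¹ • y, ⟨fun a => ?_, ?_⟩, ?_⟩
    · exact mul_nonneg (inv_nonneg.2 hs.le) (hy a).le
    · simp only [Pi.smul_apply, smul_eq_mul, ← Finset.mul_sum]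
      exact inv_mul_cancel₀ hs.ne'
    · rw [mulVec_smul]
      intro a
      exact mul_le_mul_of_nonneg_left (hh' a).le (inv_nonneg.2 hs.le)
  let K : Set (ℝ × (n → ℝ)) :=
    (Set.Icc 0 H ×ˢ stdSimplex ℝ n) ∩ {p | p.2 ≤ B p.1 *ᵥ p.2}
  have hKc : IsCompact K := by
    refine (isCompact_Icc.prod (isCompact_stdSimplex ℝ n)).inter_right ?_
    refine isClosed_le continuous_snd (continuous_pi fun a => ?_)
    exact continuous_finsetSum _ fun b _ =>
      ((hcont a b).comp continuous_fst).mul ((continuous_apply b).comp continuous_snd)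
  have hKmem : ∀ h x, 0 ≤ h → x ∈ stdSimplex ℝ n → x ≤ B h *ᵥ x → (h, x) ∈ K :=
    fun h x h0 hx hle => ⟨⟨⟨h0, (hbound h x hx hle).le⟩, hx⟩, hle⟩
  obtain ⟨y, hy, hylt⟩ := exists_pos_lt_mulVec (hB 0) (hirr 0) zero_le_one hone hne
  obtain ⟨h₁, hh₁, x₁, hx₁, hle₁⟩ := hincr 0 y hy hylt
  have hmem₁ := hKmem h₁ x₁ hh₁.le hx₁ hle₁
  obtain ⟨⟨h, x⟩, ⟨⟨-, hx⟩, hle⟩, hmax⟩ :=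
    hKc.exists_isMaxOn ⟨_, hmem₁⟩ continuous_fst.continuousOn
  have hpos : 0 < h := lt_of_lt_of_le hh₁ (hmax hmem₁)
  have hx0 : x ≠ 0 := by
    rintro rfl
    simpa using hx.2
  have heq : x = B h *ᵥ x := by
    by_contra hne'
    obtain ⟨z, hz, hzlt⟩ := exists_pos_lt_mulVec (hB h) (hirr h) hx.1 hle hne'
    obtain ⟨h₂, hh₂, x₂, hx₂, hle₂⟩ := hincr h z hz hzlt
    exact absurd (hmax (hKmem h₂ x₂ (hpos.trans hh₂).le hx₂ hle₂)) (not_le.2 hh₂)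
  exact ⟨h, hpos, x, pos_of_eq_mulVec (hB h) (hirr h) hx.1 hx0 heq, heq⟩

end Matrix

namespace SerreGraph

variable {V E : Type}

/-- `G.Step e f` says that `ef` is a combinatorial path without backtracking. -/
def Step (G : SerreGraph V E) (e f : E) : Prop := G.t e = G.i f ∧ G.bar e ≠ f

lemma Step.bar {G : SerreGraph V E} {e f : E} (h : G.Step e f) :
    G.Step (G.bar f) (G.bar e) :=
  ⟨by rw [G.t_bar, G.i_bar, h.1], by rw [G.bar_bar]; exact h.2.symm⟩

lemma step_bar_bar_iff (G : SerreGraph V E) {e f : E} :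
    G.Step (G.bar f) (G.bar e) ↔ G.Step e f :=
  ⟨fun h => by simpa only [G.bar_bar] using h.bar, Step.bar⟩

/-- Distinct edges with the same origin form a path through that origin. -/
lemma step_bar_of_ne (G : SerreGraph V E) {e f : E} (hi : G.i e = G.i f) (hne : e ≠ f) :
    G.Step (G.bar e) f :=
  ⟨by rw [G.t_bar, hi], by rwa [G.bar_bar]⟩

variable [DecidableEq V]

lemma valency_eq_card_filter [Fintype E] (G : SerreGraph V E) (x : V) :
    G.valency x = (Finset.univ.filter fun e => G.i e = x).card := by
  rw [valency, Nat.card_eq_fintype_card, Fintype.card_subtype]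

variable [DecidableEq E]

lemma rho_of_step {G : SerreGraph V E} {e f : E} (h : G.Step e f) : G.rho e f = 1 :=
  if_pos h

lemma rho_of_not_step {G : SerreGraph V E} {e f : E} (h : ¬ G.Step e f) : G.rho e f = 0 :=
  if_neg h

lemma rho_nonneg (G : SerreGraph V E) (e f : E) : 0 ≤ G.rho e f := by
  unfold rho
  split_ifs <;> norm_num

lemma rho_pos_iff (G : SerreGraph V E) {e f : E} : 0 < G.rho e f ↔ G.Step e f := by
  by_cases h : G.Step e f
  · simp [rho_of_step h, h]
  · simp [rho_of_not_step h, h]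

lemma rho_bar_bar (G : SerreGraph V E) (e f : E) :
    G.rho (G.bar f) (G.bar e) = G.rho e f := by
  by_cases h : G.Step e f
  · rw [rho_of_step h, rho_of_step h.bar]
  · rw [rho_of_not_step h, rho_of_not_step (mt G.step_bar_bar_iff.1 h)]

variable [Fintype E]

lemma sum_rho (G : SerreGraph V E) (e : E) : ∑ f, G.rho e f = (G.valency (G.t e) : ℝ) - 1 := by
  have hfilter : (Finset.univ.filter fun f => G.t e = G.i f ∧ G.bar e ≠ f) =
      (Finset.univ.filter fun f => G.i f = G.t e).erase (G.bar e) := by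
    ext f
    simp only [Finset.mem_filter, Finset.mem_univ, true_and, Finset.mem_erase]
    exact ⟨fun h => ⟨h.2.symm, h.1.symm⟩, fun h => ⟨h.2.symm, h.1.symm⟩⟩
  have hmem : G.bar e ∈ Finset.univ.filter fun f => G.i f = G.t e := by simp [G.i_bar]
  unfold rho
  rw [Finset.sum_boole, hfilter, Finset.cast_card_erase_of_mem hmem, valency_eq_card_filter]

/-- In a finite graph without terminal vertices, a set of edges closed under nonbacktracking
continuation is closed under nonbacktracking precursors. -/
lemma mem_of_step (G : SerreGraph V E) (hval : ∀ x, 2 ≤ G.valency x) {U : Set E}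
    (hU : ∀ e ∈ U, ∀ f, G.Step e f → f ∈ U) {e f : E} (hf : f ∈ U) (hef : G.Step e f) :
    e ∈ U := by
  have hpos : ∀ x, (0 : ℝ) < G.valency x - 1 := fun x => by
    have : (2 : ℝ) ≤ G.valency x := by exact_mod_cast hval x
    linarith
  let P : Matrix E E ℝ := fun a b => G.rho a b / (G.valency (G.t a) - 1)
  have hrow : ∀ a, ∑ b, P a b = 1 := fun a => by
    simp only [P, ← Finset.sum_div, sum_rho]
    exact div_self (hpos _).ne'
  have hbar : ∀ a b, P a b = P (G.bar b) (G.bar a) := fun a b => by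
    simp only [P, rho_bar_bar, G.t_bar]
    by_cases h : G.Step a b
    · rw [h.1]
    · simp [rho_of_not_step h]
  have hcol : ∀ b, ∑ a, P a b = 1 := fun b => by
    simp only [hbar _ b]
    exact (Equiv.sum_comp (Function.Involutive.toPerm G.bar G.bar_bar)
      (fun c => P (G.bar b) c)).trans (hrow _)
  have hPpos : ∀ a b, 0 < P a b ↔ G.Step a b := fun a b => by
    rw [← rho_pos_iff]
    exact div_pos_iff_of_pos_right (hpos _)
  exact Matrix.mem_of_sums_eq_one (P := P)
    (fun a b => div_nonneg (G.rho_nonneg a b) (hpos _).le) hrow hcol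
    (fun a ha b hab => hU a ha b ((hPpos a b).1 hab)) hf ((hPpos e f).2 hef)

/-- In a finite graph without terminal vertices, nonbacktracking reachability is symmetric. -/
lemma reflTransGen_step_symm (G : SerreGraph V E) (hval : ∀ x, 2 ≤ G.valency x) {e f : E}
    (h : Relation.ReflTransGen G.Step e f) : Relation.ReflTransGen G.Step f e := by
  induction h with
  | refl => exact .refl
  | @tail b c _ hbc ih =>
    have hcb : b ∈ {d | Relation.ReflTransGen G.Step c d} :=
      G.mem_of_step hval (fun a ha d had => Relation.ReflTransGen.tail ha had)
        (Relation.ReflTransGen.refl : Relation.ReflTransGen G.Step c c) hbc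
    exact Relation.ReflTransGen.trans hcb ih

/-- In a finite connected graph without terminal vertices which is not a cycle, any two edges
are joined by a path without backtracking. -/
theorem reflTransGen_step (G : SerreGraph V E) (hconn : G.Connected)
    (hval : ∀ x, 2 ≤ G.valency x) (hbig : ∃ x, 3 ≤ G.valency x) (e f : E) :
    Relation.ReflTransGen G.Step e f := by
  have symm : ∀ {a b}, Relation.ReflTransGen G.Step a b → Relation.ReflTransGen G.Step b a :=
    fun h => G.reflTransGen_step_symm hval h
  have hbar : ∀ {a b}, Relation.ReflTransGen G.Step a b →
      Relation.ReflTransGen G.Step (G.bar a) (G.bar b) := fun h =>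
    symm (h.swap.lift G.bar fun _ _ hab => hab.bar)
  obtain ⟨x, hx⟩ := hbig
  obtain ⟨a, ha, b, hb, c, hc, hab, hac, hbc⟩ : ∃ a, G.i a = x ∧ ∃ b, G.i b = x ∧
      ∃ c, G.i c = x ∧ a ≠ b ∧ a ≠ c ∧ b ≠ c := by
    rw [valency_eq_card_filter] at hx
    obtain ⟨a, b, c, ha, hb, hc, h⟩ := Finset.two_lt_card_iff.1 hx
    simp only [Finset.mem_filter, Finset.mem_univ, true_and] at ha hb hc
    exact ⟨a, ha, b, hb, c, hc, h⟩
  have haa : Relation.ReflTransGen G.Step a (G.bar a) := by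
    have h1 := Relation.ReflTransGen.single (G.step_bar_of_ne (ha.trans hb.symm) hab)
    have h2 := Relation.ReflTransGen.single (G.step_bar_of_ne (hc.trans hb.symm) hbc.symm)
    have h3 := Relation.ReflTransGen.single (G.step_bar_of_ne (hc.trans ha.symm) hac.symm)
    exact (symm h3).trans (h2.trans (symm h1))
  have hclass_bar : ∀ {d}, Relation.ReflTransGen G.Step a d →
      Relation.ReflTransGen G.Step a (G.bar d) := fun h => haa.trans (hbar h)
  have hclass_star : ∀ {d d'}, G.i d = G.i d' → Relation.ReflTransGen G.Step a d →
      Relation.ReflTransGen G.Step a d' := fun {d d'} hi h => by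
    by_cases hd : d = d'
    · exact hd ▸ h
    · exact (hclass_bar h).tail (G.step_bar_of_ne hi hd)
  let Q : V → Prop := fun v => ∃ d, G.i d = v ∧ Relation.ReflTransGen G.Step a d
  have hQ : ∀ v w, Relation.EqvGen (fun p q => ∃ d, G.i d = p ∧ G.t d = q) v w →
      (Q v ↔ Q w) := by
    intro v w h
    induction h with
    | rel v w h =>
      obtain ⟨d, rfl, rfl⟩ := h
      constructor
      · rintro ⟨d', hd', h⟩
        exact ⟨G.bar d, G.i_bar d, hclass_bar (hclass_star hd' h)⟩
      · rintro ⟨d', hd', h⟩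
        refine ⟨d, rfl, ?_⟩
        have := hclass_bar (hclass_star (hd'.trans (G.i_bar d).symm) h)
        rwa [G.bar_bar] at this
    | refl => rfl
    | symm _ _ _ ih => exact ih.symm
    | trans _ _ _ _ _ ih₁ ih₂ => exact ih₁.trans ih₂
  have hall : ∀ d, Relation.ReflTransGen G.Step a d := fun d => by
    obtain ⟨d', hd', h⟩ := (hQ _ _ (hconn (G.i a) (G.i d))).1 ⟨a, rfl, .refl⟩
    exact hclass_star hd' h
  exact (symm (hall e)).trans (hall f)

end SerreGraph

open SerreGraph in
/-- Existence: for a finite connected graph without terminal vertices which is not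
a cycle, with a length function `ℓ`, there are `h > 0` and positive `(x_e)` with
`x_e = Σ_f ρ_{ef} e^{-h ℓ(f)} x_f` for all `e`. -/
theorem exists_entropy_eigenvector
    {V E : Type} [Fintype V] [Fintype E] [DecidableEq V] [DecidableEq E]
    (G : SerreGraph V E) (hconn : G.Connected)
    (hval : ∀ x : V, 2 ≤ G.valency x) (hbig : ∃ x : V, 3 ≤ G.valency x)
    (ℓ : E → ℝ) (hℓ : G.IsLengthFunction ℓ) :
    ∃ h : ℝ, 0 < h ∧ ∃ x : E → ℝ, (∀ e, 0 < x e) ∧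
      ∀ e : E, x e = ∑ f : E, G.rho e f * Real.exp (-h * ℓ f) * x f := by
  obtain ⟨v, hv⟩ := id hbig
  obtain ⟨e₀, he₀⟩ : ∃ e, G.i e = v := by
    rw [valency_eq_card_filter] at hv
    obtain ⟨e, he⟩ := Finset.card_pos.1 (lt_of_lt_of_le three_pos hv)
    exact ⟨e, (Finset.mem_filter.1 he).2⟩
  have : Nonempty E := ⟨e₀⟩
  let B : ℝ → Matrix E E ℝ := fun h e f => G.rho e f * Real.exp (-h * ℓ f)
  have hrow : ∀ e, (B 0).mulVec 1 e = (G.valency (G.t e) : ℝ) - 1 := fun e => by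
    simp [B, Matrix.mulVec, dotProduct, sum_rho]
  obtain ⟨h, hpos, x, hx, heq⟩ := Matrix.exists_pos_fixed_vector B
    (fun h e f => mul_nonneg (G.rho_nonneg e f) (Real.exp_pos _).le)
    (fun h e f => (G.reflTransGen_step hconn hval hbig e f).lift id fun a b hab =>
      mul_pos (G.rho_pos_iff.2 hab) (Real.exp_pos _))
    (fun e f => by fun_prop)
    (fun e f => by
      have h1 : Filter.Tendsto (fun h : ℝ => -h * ℓ f) Filter.atTop Filter.atBot :=
        Filter.tendsto_neg_atTop_atBot.atBot_mul_const (hℓ.1 f)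
      simpa [B] using (Real.tendsto_exp_atBot.comp h1).const_mul (G.rho e f))
    (fun e => by
      have : (2 : ℝ) ≤ G.valency (G.t e) := by exact_mod_cast hval _
      rw [hrow, Pi.one_apply]
      linarith)
    (fun hone => by
      have h1 := congrFun hone (G.bar e₀)
      have : (3 : ℝ) ≤ G.valency v := by exact_mod_cast hv
      rw [hrow, G.t_bar, he₀, Pi.one_apply] at h1
      linarith)
  exact ⟨h, hpos, x, hx, fun e => congrFun heq e⟩
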